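/- arXiv:1403.3330 — 5 statements merged into one kernel-verified Lean document; each statement's English description precedes it below -/
import Mathlib

section
/- Let (φ_n)_{n∈ℕ}, (δ_n)_{n∈ℕ} and (α_n)_{n∈ℕ} be sequences in [0, +∞) such that φ_{n+1} ≤ φ_n + α_n(φ_n − φ_{n−1}) + δ_n for all n ≥ 1, Σ_{n∈ℕ} δ_n < +∞, and there exists a real number α with 0 ≤ α_n ≤ α < 1 for all n ∈ ℕ. Then: (i) Σ_{n≥1} [φ_n − φ_{n−1}]_+ < +∞, where [t]_+ = max{t, 0}; and (ii) there exists φ* ∈ [0, +∞) such that lim_{n→+∞} φ_n = φ*. -/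
open Filter Topology

/-- A nonnegative sequence contracting up to a summable error is summable. -/
theorem summable_of_le_mul_add {θ ε : ℕ → ℝ} {α : ℝ} (hθ : ∀ n, 0 ≤ θ n) (hε : ∀ n, 0 ≤ ε n)
    (hsum : Summable ε) (hα : α < 1) (hrec : ∀ n, θ (n + 1) ≤ α * θ n + ε n) :
    Summable θ := by
  refine summable_of_sum_range_le (c := (θ 0 + ∑' n, ε n) / (1 - α)) hθ fun n => ?_
  rw [le_div_iff₀ (by linarith)]
  have hmono : ∑ i ∈ Finset.range n, θ i ≤ ∑ i ∈ Finset.range (n + 1), θ i := by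
    rw [Finset.sum_range_succ]
    linarith [hθ n]
  have hstep : ∑ i ∈ Finset.range n, θ (i + 1) ≤
      α * ∑ i ∈ Finset.range n, θ i + ∑ i ∈ Finset.range n, ε i := by
    rw [Finset.mul_sum, ← Finset.sum_add_distrib]
    exact Finset.sum_le_sum fun i _ => hrec i
  have herr := hsum.sum_le_tsum (Finset.range n) fun i _ => hε i
  rw [Finset.sum_range_succ'] at hmono
  linarith

/-- A sequence that is bounded below and has summable positive increments converges. -/
theorem exists_tendsto_of_summable_max_sub {φ : ℕ → ℝ} (hφ : BddBelow (Set.range φ))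
    (hsum : Summable fun n => max (φ (n + 1) - φ n) 0) :
    ∃ l, Filter.Tendsto φ Filter.atTop (nhds l) := by
  obtain ⟨m, hm⟩ := hφ
  set S : ℕ → ℝ := fun n => ∑ i ∈ Finset.range n, max (φ (i + 1) - φ i) 0 with hS
  have hanti : Antitone fun n => φ n - S n := by
    refine antitone_nat_of_succ_le fun n => ?_
    simp only [hS, Finset.sum_range_succ]
    linarith [le_max_left (φ (n + 1) - φ n) 0]
  have hbdd : BddBelow (Set.range fun n => φ n - S n) := by
    refine ⟨m - ∑' n, max (φ (n + 1) - φ n) 0, ?_⟩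
    rintro _ ⟨n, rfl⟩
    exact sub_le_sub (hm ⟨n, rfl⟩)
      (hsum.sum_le_tsum (Finset.range n) fun i _ => le_max_right _ _)
  have hlim := (tendsto_atTop_ciInf hanti hbdd).add hsum.hasSum.tendsto_sum_nat
  exact ⟨_, hlim.congr fun n => sub_add_cancel (φ n) (S n)⟩

/-- a quasi-Fejér type lemma for real sequences with inertial terms. -/
theorem stmt2 (φ δ a : ℕ → ℝ) (α : ℝ)
    (hφ : ∀ n, 0 ≤ φ n) (hδnn : ∀ n, 0 ≤ δ n) (ha0 : ∀ n, 0 ≤ a n)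
    (hrec : ∀ n ≥ 1, φ (n + 1) ≤ φ n + a n * (φ n - φ (n - 1)) + δ n)
    (hsum : Summable δ)
    (haub : ∀ n, a n ≤ α) (hα : α < 1) :
    (Summable fun n => max (φ (n + 1) - φ n) 0) ∧
      ∃ φs : ℝ, 0 ≤ φs ∧ Filter.Tendsto φ Filter.atTop (nhds φs) := by
  have hincr : Summable fun n => max (φ (n + 1) - φ n) 0 := by
    refine summable_of_le_mul_add (fun n => le_max_right _ _) (fun n => hδnn (n + 1))
      ((summable_nat_add_iff 1).2 hsum) hα fun n => ?_
    have hpos : 0 ≤ max (φ (n + 1) - φ n) 0 := le_max_right _ _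
    have hα0 : 0 ≤ α := (ha0 0).trans (haub 0)
    refine max_le ?_ (add_nonneg (mul_nonneg hα0 hpos) (hδnn (n + 1)))
    have hr := hrec (n + 1) (Nat.le_add_left 1 n)
    rw [Nat.add_sub_cancel] at hr
    have hle : a (n + 1) * (φ (n + 1) - φ n) ≤ α * max (φ (n + 1) - φ n) 0 :=
      (mul_le_mul_of_nonneg_left (le_max_left _ _) (ha0 (n + 1))).trans
        (mul_le_mul_of_nonneg_right (haub (n + 1)) hpos)
    linarith
  obtain ⟨l, hl⟩ := exists_tendsto_of_summable_max_sub
    ⟨0, Set.forall_mem_range.2 hφ⟩ hincr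
  exact ⟨hincr, l, ge_of_tendsto' hl hφ, hl⟩
end

section
/- Let M be a nonempty closed affine subset of a real Hilbert space H and T : M → M a nonexpansive operator with Fix T ≠ ∅. Let x_0, x_1 ∈ M and define for every n ≥ 1: x_{n+1} = x_n + α_n(x_n − x_{n−1}) + λ_n [T(x_n + α_n(x_n − x_{n−1})) − x_n − α_n(x_n − x_{n−1})], where the inertial parameters (α_n), (λ_n), α, λ, σ, δ satisfy the stated conditions. Then Σ_{n∈ℕ} ‖x_{n+1} − x_n‖² < +∞. -/
open Filter Topology

/-- Young-type lower bound for `‖u - a • v‖ ^ 2` with weight `a + b`. -/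
theorem norm_sub_smul_sq_ge {H : Type*} [NormedAddCommGroup H] [InnerProductSpace ℝ H]
    (u v : H) {a b : ℝ} (ha : 0 ≤ a) :
    b * ‖u‖ ^ 2 - a * b * (a + b) * ‖v‖ ^ 2 ≤ (a + b) * ‖u - a • v‖ ^ 2 := by
  have h : 0 ≤ a * ‖u - (a + b) • v‖ ^ 2 := by positivity
  rw [norm_sub_sq_real, inner_smul_right, norm_smul, mul_pow, Real.norm_eq_abs, sq_abs] at h ⊢
  nlinarith

/-- One step of an inertial relaxed iteration, written with `s = x n - y`, `v = x n - x (n - 1)`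
and `d = T w - w` at the extrapolated point `w`. -/
theorem inertial_step_le {H : Type*} [NormedAddCommGroup H] [InnerProductSpace ℝ H]
    (s v d : H) {a l δ c : ℝ} (ha : 0 ≤ a) (hl : 0 < l) (hl1 : l ≤ 1) (hδ : 0 < δ)
    (hc : c * (a + δ * l) ≤ (1 - l) * δ) (hne : ‖s + a • v + d‖ ≤ ‖s + a • v‖) :
    ‖s + (a • v + l • d)‖ ^ 2 - (1 + a) * ‖s‖ ^ 2 + a * ‖s - v‖ ^ 2 ≤
      -c * ‖a • v + l • d‖ ^ 2 + (a * (1 + a) + a * (1 - l) * δ) * ‖v‖ ^ 2 := by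
  have hr : 0 < a + δ * l := by positivity
  have hyoung := norm_sub_smul_sq_ge (a • v + l • d) (b := δ * l) v ha
  rw [add_sub_cancel_left, norm_smul l d, mul_pow, Real.norm_eq_abs, sq_abs] at hyoung
  have hd : c * ‖a • v + l • d‖ ^ 2 - a * (1 - l) * δ * ‖v‖ ^ 2 ≤ l * (1 - l) * ‖d‖ ^ 2 := by
    have h1 := mul_le_mul_of_nonneg_left hyoung (sub_nonneg.2 hl1)
    have h2 := mul_le_mul_of_nonneg_right hc (mul_nonneg hl.le (sq_nonneg ‖a • v + l • d‖))
    refine le_of_mul_le_mul_left ?_ (mul_pos hr hl)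
    linarith
  have hsq : ‖s + a • v + d‖ ^ 2 ≤ ‖s + a • v‖ ^ 2 := by gcongr
  have e1 : ‖s + (a • v + l • d)‖ ^ 2 =
      (1 - l) * ‖s + a • v‖ ^ 2 + l * ‖s + a • v + d‖ ^ 2 - l * (1 - l) * ‖d‖ ^ 2 := by
    rw [← add_assoc, norm_add_sq_real (s + a • v) (l • d), norm_add_sq_real (s + a • v) d,
      inner_smul_right, norm_smul, mul_pow, Real.norm_eq_abs, sq_abs]
    ring
  have e2 : ‖s + a • v‖ ^ 2 =
      (1 + a) * ‖s‖ ^ 2 - a * ‖s - v‖ ^ 2 + a * (1 + a) * ‖v‖ ^ 2 := by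
    rw [norm_add_sq_real, norm_sub_sq_real, inner_smul_right, norm_smul, mul_pow,
      Real.norm_eq_abs, sq_abs]
    ring
  have h3 := mul_le_mul_of_nonneg_left hsq hl.le
  linarith

/-- A Lyapunov argument: a perturbed second-order descent inequality forces summability. -/
theorem summable_of_inertial_descent {φ D a γ : ℕ → ℝ} {α σ : ℝ} (hα : 0 ≤ α) (hα1 : α < 1)
    (hσ : 0 < σ) (hφ : ∀ n, 0 ≤ φ n) (hD : ∀ n, 0 ≤ D n) (hγ : ∀ n, 0 ≤ γ n)
    (ha : ∀ n, a n ≤ α) (hmono : ∀ n, a n ≤ a (n + 1))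
    (hstep : ∀ n, φ (n + 2) - (1 + a n) * φ (n + 1) + a n * φ n ≤
      -(γ (n + 1) + σ) * D (n + 1) + γ n * D n) :
    Summable D := by
  set μ : ℕ → ℝ := fun n => φ (n + 1) - a n * φ n + γ n * D n with hμ
  have hμstep (n : ℕ) : μ (n + 1) + σ * D (n + 1) ≤ μ n := by
    have := mul_le_mul_of_nonneg_right (hmono n) (hφ (n + 1))
    have := hstep n
    simp only [hμ]
    linarith
  have hsum (n : ℕ) : μ n + σ * ∑ i ∈ Finset.range n, D (i + 1) ≤ μ 0 := by
    induction n with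
    | zero => simp
    | succ n ih =>
      rw [Finset.sum_range_succ, mul_add]
      linarith [hμstep n]
  have hμlb (n : ℕ) : φ (n + 1) - α * φ n ≤ μ n := by
    have := mul_le_mul_of_nonneg_right (ha n) (hφ n)
    have := mul_nonneg (hγ n) (hD n)
    simp only [hμ]
    linarith
  have hμ0 (n : ℕ) : μ n ≤ |μ 0| := by
    have : 0 ≤ σ * ∑ i ∈ Finset.range n, D (i + 1) :=
      mul_nonneg hσ.le (Finset.sum_nonneg fun i _ => hD _)
    linarith [hsum n, le_abs_self (μ 0)]
  have hφb (n : ℕ) : φ n ≤ φ 0 + |μ 0| / (1 - α) := by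
    have h1 : 0 < 1 - α := by linarith
    induction n with
    | zero =>
      have : 0 ≤ |μ 0| / (1 - α) := by positivity
      linarith
    | succ n ih =>
      have h2 := mul_le_mul_of_nonneg_left ih hα
      have h3 : (1 - α) * (|μ 0| / (1 - α)) = |μ 0| := mul_div_cancel₀ _ h1.ne'
      have h4 := mul_nonneg h1.le (hφ 0)
      linarith [hμlb n, hμ0 n]
  refine (summable_nat_add_iff 1).1 <| summable_of_sum_range_le
    (c := (μ 0 + α * (φ 0 + |μ 0| / (1 - α))) / σ) (fun n => hD _) fun n => ?_
  rw [le_div_iff₀ hσ]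
  linarith [hsum n, hμlb n, hφ (n + 1), mul_le_mul_of_nonneg_left (hφb n) hα]

/-- inertial Krasnosel'skiĭ–Mann iteration, summability of squared increments. -/
theorem stmt4 {H : Type*} [NormedAddCommGroup H] [InnerProductSpace ℝ H] [CompleteSpace H]
    (M : Set H) (hMne : M.Nonempty) (hMcl : IsClosed M)
    (hMaff : ∀ x ∈ M, ∀ y ∈ M, ∀ t : ℝ, t • x + (1 - t) • y ∈ M)
    (T : H → H) (hTmap : ∀ x ∈ M, T x ∈ M)
    (hTne : ∀ x ∈ M, ∀ y ∈ M, ‖T x - T y‖ ≤ ‖x - y‖)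
    (hfix : ∃ y ∈ M, T y = y)
    (α lam σ δ : ℝ) (αseq lamseq : ℕ → ℝ)
    (hαnondec : ∀ n ≥ 1, αseq n ≤ αseq (n + 1)) (hα1 : αseq 1 = 0)
    (hα0 : ∀ n ≥ 1, 0 ≤ αseq n) (hαub : ∀ n ≥ 1, αseq n ≤ α) (hαlt : α < 1)
    (hlam : 0 < lam) (hσ : 0 < σ) (hδpos : 0 < δ)
    (hδ : δ > (α ^ 2 * (1 + α) + α * σ) / (1 - α ^ 2))
    (hlamlb : ∀ n ≥ 1, lam ≤ lamseq n)
    (hlamub : ∀ n ≥ 1, lamseq n ≤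
      (δ - α * (α * (1 + α) + α * δ + σ)) / (δ * (1 + α * (1 + α) + α * δ + σ)))
    (x : ℕ → H) (hx0 : x 0 ∈ M) (hx1 : x 1 ∈ M)
    (hrec : ∀ n ≥ 1, x (n + 1) = x n + αseq n • (x n - x (n - 1)) +
      lamseq n • (T (x n + αseq n • (x n - x (n - 1))) - x n - αseq n • (x n - x (n - 1)))) :
    Summable (fun n => ‖x (n + 1) - x n‖ ^ 2) := by
  obtain ⟨y, hyM, hy⟩ := hfix
  have hα : 0 ≤ α := (hα0 1 le_rfl).trans (hαub 1 le_rfl)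
  set K := α * (1 + α) + α * δ with hK
  have hK0 : 0 ≤ K := by positivity
  have hlpos (n : ℕ) : 0 < lamseq (n + 1) := hlam.trans_le (hlamlb _ (by lia))
  have hlδ (n : ℕ) : lamseq (n + 1) * (δ * (1 + K + σ)) ≤ δ - α * (K + σ) := by
    have h := hlamub (n + 1) (by lia)
    rw [le_div_iff₀ (by positivity)] at h
    rw [hK]
    linarith
  have hl1 (n : ℕ) : lamseq (n + 1) ≤ 1 := by
    have h1 : 0 ≤ α * (K + σ) := by positivity
    have h2 : 0 ≤ lamseq (n + 1) * (δ * (K + σ)) :=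
      mul_nonneg (hlpos n).le (by positivity)
    refine le_of_mul_le_mul_right ?_ hδpos
    linarith [hlδ n]
  have hαn (n : ℕ) : 0 ≤ αseq (n + 1) := hα0 _ (by lia)
  have hαn' (n : ℕ) : αseq (n + 1) ≤ α := hαub _ (by lia)
  have hxw {p q : H} (hp : p ∈ M) (hq : q ∈ M) (a : ℝ) : q + a • (q - p) ∈ M := by
    convert hMaff q hq p hp (1 + a) using 1
    module
  have hrec' (n : ℕ) : x (n + 2) = x (n + 1) + αseq (n + 1) • (x (n + 1) - x n) +
      lamseq (n + 1) • (T (x (n + 1) + αseq (n + 1) • (x (n + 1) - x n)) -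
        (x (n + 1) + αseq (n + 1) • (x (n + 1) - x n))) := by
    simpa [sub_sub] using hrec (n + 1) (by lia)
  have hxM (n : ℕ) : x n ∈ M ∧ x (n + 1) ∈ M := by
    induction n with
    | zero => exact ⟨hx0, hx1⟩
    | succ n ih =>
      refine ⟨ih.2, ?_⟩
      have hw := hxw ih.1 ih.2 (αseq (n + 1))
      rw [hrec' n]
      convert hMaff _ (hTmap _ hw) _ hw (lamseq (n + 1)) using 1
      module
  set γ : ℕ → ℝ := fun n =>
    αseq (n + 1) * (1 + αseq (n + 1)) + αseq (n + 1) * (1 - lamseq (n + 1)) * δ with hγ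
  have hγ0 (n : ℕ) : 0 ≤ γ n := by
    have := hαn n
    have := sub_nonneg.2 (hl1 n)
    positivity
  have hγK (n : ℕ) : γ n ≤ K := by
    have h1 := hαn n
    have h2 := hαn' n
    have h3 : αseq (n + 1) * (1 - lamseq (n + 1)) ≤ α * 1 :=
      mul_le_mul h2 (by linarith [hlpos n]) (sub_nonneg.2 (hl1 n)) hα
    rw [mul_one] at h3
    simp only [hγ, hK]
    gcongr
  refine summable_of_inertial_descent (φ := fun n => ‖x n - y‖ ^ 2)
    (a := fun n => αseq (n + 1)) (γ := γ) hα hαlt hσ (fun n => by positivity)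
    (fun n => by positivity) hγ0 hαn' (fun n => hαnondec _ (by lia)) fun n => ?_
  have hc : (γ (n + 1) + σ) * (αseq (n + 1) + δ * lamseq (n + 1)) ≤
      (1 - lamseq (n + 1)) * δ := by
    have h1 : (γ (n + 1) + σ) * (αseq (n + 1) + δ * lamseq (n + 1)) ≤
        (K + σ) * (α + δ * lamseq (n + 1)) := by
      have := hαn n
      have := hlpos n
      gcongr
      exacts [hγK _, hαn' n]
    linarith [hlδ n]
  set w := x (n + 1) + αseq (n + 1) • (x (n + 1) - x n) with hw
  have hwM : w ∈ M := hxw (hxM n).1 (hxM n).2 _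
  have hTw := hTne w hwM y hyM
  rw [hy] at hTw
  have h := inertial_step_le (x (n + 1) - y) (x (n + 1) - x n) (T w - w) (hαn n) (hlpos n)
    (hl1 n) hδpos hc (by
      convert hTw using 2
      · rw [hw]; module
      · rw [hw]; module)
  have e1 : αseq (n + 1) • (x (n + 1) - x n) + lamseq (n + 1) • (T w - w) =
      x (n + 2) - x (n + 1) := by
    rw [hrec' n, ← hw, hw]; module
  rw [e1, add_comm (x (n + 1) - y), sub_add_sub_cancel, sub_sub_sub_cancel_left] at h
  exact h
end

section
/- Let M be a nonempty closed affine subset of a real Hilbert space H, T : M → M nonexpansive, and y ∈ Fix T. Let x, x' ∈ M, a ≥ 0 and λ ∈ (0, 1), and set w = x + a(x − x') and x⁺ = w + λ(Tw − w). Then ‖x⁺ − y‖² − (1 + a)‖x − y‖² + a‖x' − y‖² ≤ −λ(1 − λ)‖Tw − w‖² + a(1 + a)‖x − x'‖². -/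
open Filter Topology

/-- Stewart's identity, valid for every real `t`. -/
theorem norm_sq_affine_combination {E : Type*} [NormedAddCommGroup E] [InnerProductSpace ℝ E]
    (t : ℝ) (u v : E) :
    ‖(1 - t) • u + t • v‖ ^ 2 =
      (1 - t) * ‖u‖ ^ 2 + t * ‖v‖ ^ 2 - t * (1 - t) * ‖u - v‖ ^ 2 := by
  rw [norm_add_sq_real, norm_sub_sq_real, norm_smul, norm_smul, mul_pow, mul_pow,
    Real.norm_eq_abs, Real.norm_eq_abs, sq_abs, sq_abs, real_inner_smul_left,
    real_inner_smul_right]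
  ring

/-- the one-step estimate for a relaxed inertial step of a nonexpansive
operator on a closed affine set. -/
theorem stmt6 {H : Type*} [NormedAddCommGroup H] [InnerProductSpace ℝ H] [CompleteSpace H]
    (M : Set H) (hMne : M.Nonempty) (hMcl : IsClosed M)
    (hMaff : ∀ x ∈ M, ∀ y ∈ M, ∀ t : ℝ, t • x + (1 - t) • y ∈ M)
    (T : H → H) (hTmap : ∀ x ∈ M, T x ∈ M)
    (hTne : ∀ x ∈ M, ∀ y ∈ M, ‖T x - T y‖ ≤ ‖x - y‖)
    (y : H) (hyM : y ∈ M) (hyfix : T y = y)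
    (x x' : H) (hx : x ∈ M) (hx' : x' ∈ M)
    (a : ℝ) (ha : 0 ≤ a) (lam : ℝ) (hlam0 : 0 < lam) (hlam1 : lam < 1)
    (w xplus : H) (hw : w = x + a • (x - x')) (hxplus : xplus = w + lam • (T w - w)) :
    ‖xplus - y‖ ^ 2 - (1 + a) * ‖x - y‖ ^ 2 + a * ‖x' - y‖ ^ 2 ≤
      -(lam * (1 - lam)) * ‖T w - w‖ ^ 2 + a * (1 + a) * ‖x - x'‖ ^ 2 := by
  have hwM : w ∈ M := by
    have h := hMaff x hx x' hx' (1 + a)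
    have hcomb : (1 + a) • x + (1 - (1 + a)) • x' = w := by rw [hw]; module
    rwa [hcomb] at h
  have hT : ‖T w - y‖ ^ 2 ≤ ‖w - y‖ ^ 2 := by
    have h := hTne w hwM y hyM
    rw [hyfix] at h
    gcongr
  have hrelax := norm_sq_affine_combination lam (w - y) (T w - y)
  have hinertial := norm_sq_affine_combination (-a) (x - y) (x' - y)
  have hxplus_sub : (1 - lam) • (w - y) + lam • (T w - y) = xplus - y := by
    rw [hxplus]; module
  have hw_sub : (1 - -a) • (x - y) + (-a) • (x' - y) = w - y := by rw [hw]; module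
  rw [hxplus_sub, sub_sub_sub_cancel_right, norm_sub_rev w (T w)] at hrelax
  rw [hw_sub, sub_sub_sub_cancel_right] at hinertial
  linarith [mul_le_mul_of_nonneg_left hT hlam0.le]
end

section
/- Let α ∈ [0, 1) and σ, δ > 0 satisfy δ > (α²(1+α) + ασ)/(1 − α²). Let a ∈ [0, α], let λ ∈ (0, 1) satisfy λ ≤ [δ − α(α(1+α) + αδ + σ)] / [δ(1 + α(1+α) + αδ + σ)], set ρ = 1/(a + δλ), and let g be any real number with 0 ≤ g ≤ α(1+α) + αδ. Then (1 − λ)(aρ − 1)/λ + g ≤ −σ. -/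
/-- the key scalar inequality used in the convergence proof of the inertial
Krasnosel'skiĭ–Mann algorithm. -/
theorem stmt7 (α σ δ a lam ρ g : ℝ)
    (hα0 : 0 ≤ α) (hα1 : α < 1) (hσ : 0 < σ) (hδpos : 0 < δ)
    (hδ : δ > (α ^ 2 * (1 + α) + α * σ) / (1 - α ^ 2))
    (ha0 : 0 ≤ a) (haα : a ≤ α)
    (hlam0 : 0 < lam) (hlam1 : lam < 1)
    (hlamub : lam ≤ (δ - α * (α * (1 + α) + α * δ + σ)) /
      (δ * (1 + α * (1 + α) + α * δ + σ)))
    (hρ : ρ = 1 / (a + δ * lam))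
    (hg0 : 0 ≤ g) (hg : g ≤ α * (1 + α) + α * δ) :
    (1 - lam) * (a * ρ - 1) / lam + g ≤ -σ := by
  have hδlam : 0 < δ * lam := mul_pos hδpos hlam0
  have hden : 0 < a + δ * lam := by linarith
  have hM : 0 ≤ α * (1 + α) + α * δ + σ := by positivity
  have hlam : lam * (δ * (1 + α * (1 + α) + α * δ + σ)) ≤
      δ - α * (α * (1 + α) + α * δ + σ) :=
    (le_div_iff₀ (by positivity)).mp hlamub
  have hprod : (g + σ) * (a + δ * lam) ≤ (α * (1 + α) + α * δ + σ) * (α + δ * lam) :=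
    mul_le_mul (by linarith) (by linarith) hden.le hM
  have hfrac : g + σ ≤ (1 - lam) * δ / (a + δ * lam) := by
    rw [le_div_iff₀ hden]
    linarith
  have hrewrite : (1 - lam) * (a * ρ - 1) / lam = -((1 - lam) * δ / (a + δ * lam)) := by
    rw [hρ]
    field_simp
    ring
  linarith
end

section
/- Let M be a nonempty closed affine subset of a real Hilbert space H, T : M → M nonexpansive with Fix T ≠ ∅, and let y ∈ Fix T. Let x_0, x_1 ∈ M and define for every n ≥ 1: x_{n+1} = x_n + α_n(x_n − x_{n−1}) + λ_n [T(x_n + α_n(x_n − x_{n−1})) − x_n − α_n(x_n − x_{n−1})], with inertial parameters (α_n), (λ_n), α, λ, σ, δ satisfying the stated conditions. Define φ_n = ‖x_n − y‖² for n ∈ ℕ, γ_n = α_n(1 + α_n) + α_n(1 − λ_n)δ and μ_n = φ_n − α_n φ_{n−1} + γ_n ‖x_n − x_{n−1}‖² for n ≥ 1. Then μ_{n+1} − μ_n ≤ −σ ‖x_{n+1} − x_n‖² for all n ≥ 1. -/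
open Filter Topology

/-- One Krasnosel'skiĭ–Mann step `w + l • (z - w)` with relaxation `l ≥ 0` from `w`, where `z` is no
farther from `y` than `w` is. -/
lemma norm_relaxed_step_sub_sq_le {H : Type*} [NormedAddCommGroup H] [InnerProductSpace ℝ H]
    {w z y : H} {l : ℝ} (hl : 0 ≤ l) (h : ‖z - y‖ ≤ ‖w - y‖) :
    ‖w + l • (z - w) - y‖ ^ 2 ≤ ‖w - y‖ ^ 2 - l * (1 - l) * ‖z - w‖ ^ 2 := by
  have hz : z - y = (w - y) + (z - w) := by abel
  have hstep : w + l • (z - w) - y = (w - y) + l • (z - w) := by abel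
  have hsq : ‖z - y‖ ^ 2 ≤ ‖w - y‖ ^ 2 := by gcongr
  rw [hz, norm_add_sq_real] at hsq
  rw [hstep, norm_add_sq_real, inner_smul_right, norm_smul, mul_pow, Real.norm_eq_abs, sq_abs]
  nlinarith [mul_le_mul_of_nonneg_left hsq hl]

/-- Norm of an extrapolated point `p + a • (p - q)` relative to `y`. -/
lemma norm_extrapolation_sub_sq {H : Type*} [NormedAddCommGroup H] [InnerProductSpace ℝ H]
    (p q y : H) (a : ℝ) :
    ‖p + a • (p - q) - y‖ ^ 2 =
      (1 + a) * ‖p - y‖ ^ 2 - a * ‖q - y‖ ^ 2 + a * (1 + a) * ‖p - q‖ ^ 2 := by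
  have hw : p + a • (p - q) - y = (p - y) + a • (p - q) := by abel
  have hq : q - y = (p - y) - (p - q) := by abel
  rw [hw, hq, norm_add_sq_real, norm_sub_sq_real (p - y), inner_smul_right, norm_smul, mul_pow,
    Real.norm_eq_abs, sq_abs]
  ring

/-- A weighted Young inequality for `l • u = d - a • e`. -/
lemma le_mul_norm_sq_of_smul_eq_sub {H : Type*} [NormedAddCommGroup H] [InnerProductSpace ℝ H]
    {d e u : H} {a l δ : ℝ} (ha : 0 ≤ a) (hl : 0 < l) (hδ : 0 < δ) (hu : l • u = d - a • e) :
    δ / (a + δ * l) * ‖d‖ ^ 2 - a * δ * ‖e‖ ^ 2 ≤ l * ‖u‖ ^ 2 := by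
  have hs : 0 < a + δ * l := by positivity
  have hsq : l ^ 2 * ‖u‖ ^ 2 = ‖d‖ ^ 2 - 2 * (a * inner ℝ d e) + a ^ 2 * ‖e‖ ^ 2 := by
    have := congrArg (fun v : H => ‖v‖ ^ 2) hu
    simpa [norm_sub_sq_real, inner_smul_right, norm_smul, mul_pow] using this
  have hyoung : 0 ≤ ‖d‖ ^ 2 - 2 * ((a + δ * l) * inner ℝ d e) + (a + δ * l) ^ 2 * ‖e‖ ^ 2 := by
    have := sq_nonneg ‖d - (a + δ * l) • e‖
    rwa [norm_sub_sq_real, inner_smul_right, norm_smul, mul_pow, Real.norm_eq_abs, sq_abs] at this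
  have hdiv : δ / (a + δ * l) * ‖d‖ ^ 2 = δ * ‖d‖ ^ 2 / (a + δ * l) := by ring
  rw [hdiv, sub_le_iff_le_add, div_le_iff₀ hs]
  refine le_of_mul_le_mul_left ?_ hl
  linear_combination a * hyoung - (a + δ * l) * hsq

/-- The upper bound on the relaxation parameters keeps them below `1` and gives the estimate that
absorbs the inertial terms. -/
lemma relaxation_bounds {α σ δ l : ℝ} (hα : 0 ≤ α) (hσ : 0 < σ) (hδ : 0 < δ)
    (hl : l ≤ (δ - α * (α * (1 + α) + α * δ + σ)) / (δ * (1 + α * (1 + α) + α * δ + σ))) :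
    l ≤ 1 ∧ (α + δ * l) * (α * (1 + α) + α * δ + σ) ≤ δ * (1 - l) := by
  have hS : 0 < α * (1 + α) + α * δ + σ := by positivity
  have hden : 0 < δ * (1 + α * (1 + α) + α * δ + σ) := by positivity
  refine ⟨hl.trans ((div_le_one hden).2 ?_), ?_⟩
  · nlinarith [mul_nonneg hα hS.le, mul_pos hδ hS]
  · have := (le_div_iff₀ hden).1 hl
    linarith

/-- monotone decrease of the energy sequence `μ_n` in the inertial
Krasnosel'skiĭ–Mann algorithm. -/
theorem stmt8 {H : Type*} [NormedAddCommGroup H] [InnerProductSpace ℝ H] [CompleteSpace H]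
    (M : Set H) (hMne : M.Nonempty) (hMcl : IsClosed M)
    (hMaff : ∀ x ∈ M, ∀ y ∈ M, ∀ t : ℝ, t • x + (1 - t) • y ∈ M)
    (T : H → H) (hTmap : ∀ x ∈ M, T x ∈ M)
    (hTne : ∀ x ∈ M, ∀ y ∈ M, ‖T x - T y‖ ≤ ‖x - y‖)
    (hfixne : ∃ w ∈ M, T w = w)
    (y : H) (hyM : y ∈ M) (hyfix : T y = y)
    (α lam σ δ : ℝ) (αseq lamseq : ℕ → ℝ)
    (hαnondec : ∀ n ≥ 1, αseq n ≤ αseq (n + 1)) (hα1 : αseq 1 = 0)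
    (hα0 : ∀ n ≥ 1, 0 ≤ αseq n) (hαub : ∀ n ≥ 1, αseq n ≤ α) (hαlt : α < 1)
    (hlam : 0 < lam) (hσ : 0 < σ) (hδpos : 0 < δ)
    (hδ : δ > (α ^ 2 * (1 + α) + α * σ) / (1 - α ^ 2))
    (hlamlb : ∀ n ≥ 1, lam ≤ lamseq n)
    (hlamub : ∀ n ≥ 1, lamseq n ≤
      (δ - α * (α * (1 + α) + α * δ + σ)) / (δ * (1 + α * (1 + α) + α * δ + σ)))
    (x : ℕ → H) (hx0 : x 0 ∈ M) (hx1 : x 1 ∈ M)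
    (hrec : ∀ n ≥ 1, x (n + 1) = x n + αseq n • (x n - x (n - 1)) +
      lamseq n • (T (x n + αseq n • (x n - x (n - 1))) - x n - αseq n • (x n - x (n - 1))))
    (φ γseq μ : ℕ → ℝ)
    (hφ : ∀ n, φ n = ‖x n - y‖ ^ 2)
    (hγ : ∀ n ≥ 1, γseq n = αseq n * (1 + αseq n) + αseq n * (1 - lamseq n) * δ)
    (hμ : ∀ n ≥ 1, μ n = φ n - αseq n * φ (n - 1) + γseq n * ‖x n - x (n - 1)‖ ^ 2) :
    ∀ n ≥ 1, μ (n + 1) - μ n ≤ -σ * ‖x (n + 1) - x n‖ ^ 2 := by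
  have hα : 0 ≤ α := (hα0 1 le_rfl).trans (hαub 1 le_rfl)
  have hextr : ∀ p ∈ M, ∀ q ∈ M, ∀ t : ℝ, p + t • (p - q) ∈ M := fun p hp q hq t => by
    have := hMaff p hp q hq (1 + t)
    rwa [show (1 + t) • p + (1 - (1 + t)) • q = p + t • (p - q) by module] at this
  have hrec' : ∀ n, x (n + 2) = (x (n + 1) + αseq (n + 1) • (x (n + 1) - x n)) +
      lamseq (n + 1) • (T (x (n + 1) + αseq (n + 1) • (x (n + 1) - x n)) -
        (x (n + 1) + αseq (n + 1) • (x (n + 1) - x n))) := fun n => by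
    rw [← sub_sub]
    exact hrec (n + 1) (by omega)
  have hmem : ∀ n, x n ∈ M ∧ x (n + 1) ∈ M := fun n => by
    induction n with
    | zero => exact ⟨hx0, hx1⟩
    | succ n ih =>
      refine ⟨ih.2, ?_⟩
      have hw := hextr _ ih.2 _ ih.1 (αseq (n + 1))
      have := hextr _ hw _ (hTmap _ hw) (-lamseq (n + 1))
      rw [hrec' n]
      convert this using 1
      module
  intro n hn
  obtain ⟨k, rfl⟩ : ∃ k, n = k + 1 := ⟨n - 1, by omega⟩
  rw [hμ (k + 1 + 1) (by omega), hμ (k + 1) hn, hγ (k + 1 + 1) (by omega), hγ (k + 1) hn,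
    hφ, hφ, hφ, hφ]
  simp only [Nat.add_sub_cancel]
  have hwM := hextr _ (hmem k).2 _ (hmem k).1 (αseq (k + 1))
  have hstep := hrec' k
  have hextrap := norm_extrapolation_sub_sq (x (k + 1)) (x k) y (αseq (k + 1))
  set w := x (k + 1) + αseq (k + 1) • (x (k + 1) - x k) with hw
  have hTw : ‖T w - y‖ ≤ ‖w - y‖ := by simpa only [hyfix] using hTne w hwM y hyM
  have hl : 0 < lamseq (k + 1) := hlam.trans_le (hlamlb _ hn)
  have hl' : 0 < lamseq (k + 1 + 1) := hlam.trans_le (hlamlb _ (by omega))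
  have hdesc := norm_relaxed_step_sub_sq_le hl.le hTw
  rw [← hstep, hextrap] at hdesc
  have hu : lamseq (k + 1) • (T w - w) =
      (x (k + 1 + 1) - x (k + 1)) - αseq (k + 1) • (x (k + 1) - x k) := by
    rw [hstep, sub_sub, ← hw, add_sub_cancel_left]
  have ha := hα0 (k + 1) hn
  have ha' := hα0 (k + 1 + 1) (by omega)
  have haα := hαub (k + 1) hn
  have haα' := hαub (k + 1 + 1) (by omega)
  obtain ⟨hl1, hbound⟩ := relaxation_bounds hα hσ hδpos (hlamub (k + 1) hn)
  obtain ⟨hl1', -⟩ := relaxation_bounds hα hσ hδpos (hlamub (k + 1 + 1) (by omega))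
  have hyoung := mul_le_mul_of_nonneg_left (le_mul_norm_sq_of_smul_eq_sub ha hl hδpos hu)
    (sub_nonneg.2 hl1)
  have hs : 0 < αseq (k + 1) + δ * lamseq (k + 1) := by positivity
  have hγle : αseq (k + 1 + 1) * (1 + αseq (k + 1 + 1)) +
      αseq (k + 1 + 1) * (1 - lamseq (k + 1 + 1)) * δ ≤ α * (1 + α) + α * δ := by
    have h : αseq (k + 1 + 1) * (1 - lamseq (k + 1 + 1)) ≤ α * 1 :=
      mul_le_mul haα' (by linarith) (by linarith) hα
    rw [mul_one] at h
    gcongr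
  have hcoef : αseq (k + 1 + 1) * (1 + αseq (k + 1 + 1)) +
      αseq (k + 1 + 1) * (1 - lamseq (k + 1 + 1)) * δ + σ ≤
      (1 - lamseq (k + 1)) * (δ / (αseq (k + 1) + δ * lamseq (k + 1))) := by
    rw [← mul_div_assoc, le_div_iff₀ hs]
    have hS : 0 ≤ α * (1 + α) + α * δ + σ := by positivity
    calc _ ≤ (α * (1 + α) + α * δ + σ) * (α + δ * lamseq (k + 1)) := by gcongr
      _ ≤ _ := by linarith
  have hD := mul_le_mul_of_nonneg_right hcoef (sq_nonneg ‖x (k + 1 + 1) - x (k + 1)‖)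
  have hφle := mul_le_mul_of_nonneg_right (hαnondec (k + 1) hn) (sq_nonneg ‖x (k + 1) - y‖)
  linarith
end
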